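/- (Uniqueness for the linear parabolic equation among sub-quadratic solutions.) Let t < T and K > 0, and let g : [t,T]×ℝⁿ → ℝⁿ be continuous with |g(s,x)| ≤ K(1+|x|). Suppose J : [t,T]×ℝⁿ → ℝ is continuous, C¹ in s and C² in x on [t,T)×ℝⁿ, satisfies the homogeneous equation −∂_s J + 𝒜J − g·DJ = 0 on [t,T)×ℝⁿ with J(T,·) = 0, and sup_{s∈[t,T]} |J(s,x)|/(1+|x|²) → 0 as |x| → ∞. Then J ≡ 0 on [t,T]×ℝⁿ. Consequently, two solutions of −∂_s J + 𝒜J − g·DJ = l with the same terminal data l_T, whose difference is o(1+|x|²) as |x| → ∞ uniformly in s, coincide. -/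

import Mathlib

open Real MeasureTheory Matrix
open scoped RealInnerProductSpace

noncomputable section

abbrev Euc (n : ℕ) := EuclideanSpace ℝ (Fin n)

/-- Second partial derivative `∂²φ/(∂x_i ∂x_j)(x)`. -/
def secondPartial (n : ℕ) (φ : Euc n → ℝ) (x : Euc n) (i j : Fin n) : ℝ :=
  fderiv ℝ (fun y => fderiv ℝ φ y (EuclideanSpace.single j 1)) x (EuclideanSpace.single i 1)

/-- The operator `𝒜φ(x) = −(1/2)·∑_{i,j} a_{ij}·∂²φ/(∂x_i∂x_j)(x)`. -/
def opA (n : ℕ) (a : Matrix (Fin n) (Fin n) ℝ) (φ : Euc n → ℝ) (x : Euc n) : ℝ :=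
  -(1 / 2) * ∑ i, ∑ j, a i j * secondPartial n φ x i j

/-- Second-order necessary condition at a local maximum of a `C²` function. -/
theorem fderiv_fderiv_apply_self_nonpos_of_isLocalMax {E : Type*} [NormedAddCommGroup E]
    [NormedSpace ℝ E] {φ : E → ℝ} (hφ : ContDiff ℝ 2 φ) {x : E} (hx : IsLocalMax φ x) (v : E) :
    fderiv ℝ (fderiv ℝ φ) x v v ≤ 0 := by
  by_contra! hpos
  have hline (r : ℝ) : HasDerivAt (fun r : ℝ => x + r • v) v r := by
    simpa using ((hasDerivAt_id r).smul_const v).const_add x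
  have h1 (r : ℝ) : HasDerivAt (fun r : ℝ => φ (x + r • v)) (fderiv ℝ φ (x + r • v) v) r :=
    ((hφ.differentiable (by norm_num)) (x + r • v)).hasFDerivAt.comp_hasDerivAt r (hline r)
  have hd : deriv (fun r : ℝ => φ (x + r • v)) = fun r => fderiv ℝ φ (x + r • v) v :=
    funext fun r => (h1 r).deriv
  have hdiff : Differentiable ℝ (fderiv ℝ φ) :=
    (hφ.fderiv_right (m := 1) (by norm_num)).differentiable (by norm_num)
  have h2 : HasDerivAt (fun r : ℝ => fderiv ℝ φ (x + r • v) v) (fderiv ℝ (fderiv ℝ φ) x v v) 0 := by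
    have h := (hdiff (x + (0 : ℝ) • v)).hasFDerivAt.comp_hasDerivAt (0 : ℝ) (hline 0)
    simpa using h.clm_apply (hasDerivAt_const (0 : ℝ) v)
  have hcont : ContinuousAt (fun r : ℝ => x + r • v) 0 := (hline 0).continuousAt
  have hmax : IsLocalMax (fun r : ℝ => φ (x + r • v)) 0 := by
    have hx' : IsLocalMax φ (x + (0 : ℝ) • v) := by simpa using hx
    exact hcont.eventually hx'
  have hmin : IsLocalMin (fun r : ℝ => φ (x + r • v)) 0 := by
    refine isLocalMin_of_deriv_deriv_pos ?_ hmax.deriv_eq_zero (h1 0).continuousAt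
    rw [hd, h2.deriv]
    exact hpos
  have heq : (fun r : ℝ => φ (x + r • v)) =ᶠ[nhds 0] fun _ => φ (x + (0 : ℝ) • v) := by
    filter_upwards [hmax, hmin] with r hr₁ hr₂ using le_antisymm hr₁ hr₂
  have h0 := heq.deriv.deriv_eq
  rw [hd, h2.deriv] at h0
  simp at h0
  exact hpos.ne' h0

theorem secondPartial_eq_fderiv_fderiv {n : ℕ} {φ : Euc n → ℝ} (hφ : ContDiff ℝ 2 φ) (x : Euc n)
    (i j : Fin n) :
    secondPartial n φ x i j =
      fderiv ℝ (fderiv ℝ φ) x (EuclideanSpace.single i 1) (EuclideanSpace.single j 1) := by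
  have hdiff : Differentiable ℝ (fderiv ℝ φ) :=
    (hφ.fderiv_right (m := 1) (by norm_num)).differentiable (by norm_num)
  unfold secondPartial
  rw [fderiv_clm_apply (hdiff x) (differentiableAt_const _)]
  simp

theorem opA_sub {n : ℕ} (a : Matrix (Fin n) (Fin n) ℝ) {φ ψ : Euc n → ℝ} (hφ : ContDiff ℝ 2 φ)
    (hψ : ContDiff ℝ 2 ψ) (x : Euc n) :
    opA n a (fun y => φ y - ψ y) x = opA n a φ x - opA n a ψ x := by
  have h1 : fderiv ℝ (fun y => φ y - ψ y) = fun y => fderiv ℝ φ y - fderiv ℝ ψ y :=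
    funext fun y => fderiv_fun_sub ((hφ.differentiable (by norm_num)) y)
      ((hψ.differentiable (by norm_num)) y)
  have h2 : fderiv ℝ (fderiv ℝ fun y => φ y - ψ y) x =
      fderiv ℝ (fderiv ℝ φ) x - fderiv ℝ (fderiv ℝ ψ) x := by
    rw [h1]
    exact fderiv_fun_sub
      ((hφ.fderiv_right (m := 1) (by norm_num)).differentiable (by norm_num) x)
      ((hψ.fderiv_right (m := 1) (by norm_num)).differentiable (by norm_num) x)
  simp only [opA, secondPartial_eq_fderiv_fderiv hφ, secondPartial_eq_fderiv_fderiv hψ,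
    secondPartial_eq_fderiv_fderiv (hφ.sub hψ), h2, _root_.sub_apply, mul_sub,
    Finset.sum_sub_distrib]

theorem gradient_fun_sub {E : Type*} [NormedAddCommGroup E] [InnerProductSpace ℝ E]
    [CompleteSpace E] {φ ψ : E → ℝ} {x : E} (hφ : DifferentiableAt ℝ φ x)
    (hψ : DifferentiableAt ℝ ψ x) :
    gradient (fun y => φ y - ψ y) x = gradient φ x - gradient ψ x := by
  simp only [gradient, fderiv_fun_sub hφ hψ, map_sub]

theorem bilinear_sum_eq {n : ℕ} (σM : Matrix (Fin n) (Fin n) ℝ) (B : Euc n →L[ℝ] Euc n →L[ℝ] ℝ) :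
    ∑ i, ∑ j, (σM * σMᵀ) i j * B (EuclideanSpace.single i 1) (EuclideanSpace.single j 1) =
      ∑ k, B (∑ i, σM i k • EuclideanSpace.single i 1) (∑ i, σM i k • EuclideanSpace.single i 1) := by
  simp only [map_sum, map_smul, _root_.sum_apply, _root_.smul_apply,
    smul_eq_mul, Matrix.mul_apply, Matrix.transpose_apply, Finset.sum_mul, Finset.mul_sum]
  rw [Finset.sum_comm' (t' := Finset.univ) (s' := fun _ => Finset.univ) (by simp)]
  rw [Finset.sum_congr rfl fun j _ => Finset.sum_comm, Finset.sum_comm]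
  refine Finset.sum_congr rfl fun k _ => Finset.sum_congr rfl fun j _ =>
    Finset.sum_congr rfl fun i _ => ?_
  ring

theorem opA_nonneg_of_isLocalMax {n : ℕ} (σM : Matrix (Fin n) (Fin n) ℝ) {φ : Euc n → ℝ}
    (hφ : ContDiff ℝ 2 φ) {x : Euc n} (hx : IsLocalMax φ x) : 0 ≤ opA n (σM * σMᵀ) φ x := by
  simp only [opA, secondPartial_eq_fderiv_fderiv hφ, bilinear_sum_eq]
  have := Finset.sum_nonpos fun k (_ : k ∈ Finset.univ) =>
    fderiv_fderiv_apply_self_nonpos_of_isLocalMax hφ hx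
      (∑ i, σM i k • EuclideanSpace.single i (1 : ℝ))
  linarith

theorem hasFDerivAt_const_mul_one_add_norm_sq {E : Type*} [NormedAddCommGroup E]
    [InnerProductSpace ℝ E] (c : ℝ) (x : E) :
    HasFDerivAt (fun y : E => c * (1 + ‖y‖ ^ 2)) ((2 * c) • innerSL ℝ x) x := by
  refine (((hasStrictFDerivAt_norm_sq x).hasFDerivAt.const_add 1).const_mul c).congr_fderiv ?_
  ext y
  simp
  ring

theorem gradient_const_mul_one_add_norm_sq {E : Type*} [NormedAddCommGroup E]
    [InnerProductSpace ℝ E] [CompleteSpace E] (c : ℝ) (x : E) :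
    gradient (fun y : E => c * (1 + ‖y‖ ^ 2)) x = (2 * c) • x := by
  refine HasGradientAt.gradient ?_
  rw [hasGradientAt_iff_hasFDerivAt]
  refine (hasFDerivAt_const_mul_one_add_norm_sq c x).congr_fderiv ?_
  ext y
  simp

theorem opA_const_mul_one_add_norm_sq {n : ℕ} (a : Matrix (Fin n) (Fin n) ℝ) (c : ℝ) (x : Euc n) :
    opA n a (fun y => c * (1 + ‖y‖ ^ 2)) x = -(c * a.trace) := by
  have h (i j : Fin n) : secondPartial n (fun y => c * (1 + ‖y‖ ^ 2)) x i j =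
      if i = j then 2 * c else 0 := by
    have h1 : (fun y : Euc n => fderiv ℝ (fun y : Euc n => c * (1 + ‖y‖ ^ 2)) y
        (EuclideanSpace.single j 1)) = (((2 * c) • EuclideanSpace.proj j : Euc n →L[ℝ] ℝ)) := by
      ext y
      rw [(hasFDerivAt_const_mul_one_add_norm_sq c y).fderiv]
      simp [EuclideanSpace.inner_single_right]
    rw [secondPartial, h1, ContinuousLinearMap.fderiv]
    by_cases hij : i = j
    · simp [hij]
    · simp [hij, Ne.symm hij]
  simp only [opA, h, mul_ite, mul_zero, Finset.sum_ite_eq, Finset.mem_univ, if_true, Matrix.trace,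
    Matrix.diag_apply, ← Finset.sum_mul]
  ring

/-- A function attaining its maximum over `[s, T]` at the left endpoint has nonpositive
derivative there. -/
theorem deriv_nonpos_of_forall_Icc_le {f : ℝ → ℝ} {s T f' : ℝ} (hsT : s < T)
    (hf : HasDerivAt f f' s) (hmax : ∀ r ∈ Set.Icc s T, f r ≤ f s) : f' ≤ 0 := by
  have h := (hasDerivAt_iff_tendsto_slope.1 hf).mono_left
    (nhdsWithin_mono s fun r (hr : r ∈ Set.Ioi s) => (ne_of_gt hr : r ≠ s))
  refine le_of_tendsto h ?_
  filter_upwards [Ioc_mem_nhdsGT hsT] with r hr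
  rw [slope_def_field]
  exact div_nonpos_of_nonpos_of_nonneg (sub_nonpos.2 (hmax r ⟨hr.1.le, hr.2⟩))
    (sub_nonneg.2 hr.1.le)

/-- Maximum principle: a sub-quadratic solution of the homogeneous equation with zero terminal
data is nonpositive. -/
theorem linear_parabolic_nonpos {n : ℕ} (σM : Matrix (Fin n) (Fin n) ℝ) {t T K : ℝ} (hK : 0 < K)
    {g : ℝ → Euc n → Euc n}
    (hg : ∀ s ∈ Set.Icc t T, ∀ x : Euc n, ‖g s x‖ ≤ K * (1 + ‖x‖)) {J : ℝ → Euc n → ℝ}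
    (hJ : ContinuousOn (fun p : ℝ × Euc n => J p.1 p.2) (Set.Icc t T ×ˢ Set.univ))
    (hJs : ∀ x : Euc n, ∀ s ∈ Set.Ico t T, DifferentiableAt ℝ (fun σ' => J σ' x) s)
    (hJx : ∀ s ∈ Set.Ico t T, ContDiff ℝ 2 (J s))
    (heq : ∀ s ∈ Set.Ico t T, ∀ x : Euc n,
      -(deriv (fun σ' => J σ' x) s) + opA n (σM * σMᵀ) (J s) x - ⟪g s x, gradient (J s) x⟫ = 0)
    (hT : ∀ x : Euc n, J T x = 0)
    (hsub : ∀ ε > (0 : ℝ), ∃ R : ℝ, ∀ x : Euc n, R ≤ ‖x‖ → ∀ s ∈ Set.Icc t T,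
      |J s x| ≤ ε * (1 + ‖x‖ ^ 2))
    {s : ℝ} (hs : s ∈ Set.Icc t T) (x : Euc n) : J s x ≤ 0 := by
  set τ : ℝ := (σM * σMᵀ).trace
  set c : ℝ := |τ| + 4 * K + 1
  have hc : 0 < c := by positivity
  have key : ∀ δ > (0 : ℝ), J s x ≤ δ * rexp (c * (T - s)) * (1 + ‖x‖ ^ 2) := by
    intro δ hδ
    by_contra! hlt
    obtain ⟨R, hR⟩ := hsub δ hδ
    let w : ℝ × Euc n → ℝ := fun p => J p.1 p.2 - δ * rexp (c * (T - p.1)) * (1 + ‖p.2‖ ^ 2)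
    have hwcont : ContinuousOn w (Set.Icc t T ×ˢ Metric.closedBall 0 (max R ‖x‖)) := by
      refine (hJ.mono (Set.prod_mono_right (Set.subset_univ _))).sub (Continuous.continuousOn ?_)
      fun_prop
    have hx : ((s, x) : ℝ × Euc n) ∈ Set.Icc t T ×ˢ Metric.closedBall 0 (max R ‖x‖) :=
      ⟨hs, by simp⟩
    obtain ⟨⟨r, y⟩, ⟨hr, -⟩, hmax⟩ :=
      (isCompact_Icc.prod (isCompact_closedBall (0 : Euc n) (max R ‖x‖))).exists_isMaxOn ⟨_, hx⟩
        hwcont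
    have hwpos : 0 < w (r, y) := lt_of_lt_of_le (sub_pos.2 hlt) (hmax hx)
    have hrT : r ≠ T := by
      rintro rfl
      have : w (r, y) ≤ 0 := by
        simp only [w, hT, zero_sub, neg_nonpos]
        positivity
      linarith
    have hyR : ‖y‖ < R := by
      by_contra! hy
      have h1 := (le_abs_self _).trans (hR y hy r hr)
      have h2 : 1 ≤ rexp (c * (T - r)) := Real.one_le_exp (mul_nonneg hc.le (sub_nonneg.2 hr.2))
      have h3 : δ * (1 + ‖y‖ ^ 2) ≤ δ * rexp (c * (T - r)) * (1 + ‖y‖ ^ 2) := by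
        gcongr
        exact le_mul_of_one_le_right hδ.le h2
      exact absurd hwpos (not_lt.2 (sub_nonpos.2 (h1.trans h3)))
    have hr' : r ∈ Set.Ico t T := ⟨hr.1, lt_of_le_of_ne hr.2 hrT⟩
    set e : ℝ := δ * rexp (c * (T - r))
    have he : 0 < e := by positivity
    have hψ : ContDiff ℝ 2 fun z : Euc n => e * (1 + ‖z‖ ^ 2) :=
      contDiff_const.mul (contDiff_const.add (contDiff_norm_sq ℝ))
    have hlocmax : IsLocalMax (fun z : Euc n => J r z - e * (1 + ‖z‖ ^ 2)) y := by
      have hball : Metric.closedBall (0 : Euc n) (max R ‖x‖) ∈ nhds y :=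
        Metric.closedBall_mem_nhds_of_mem (by simp [hyR])
      filter_upwards [hball] with z hz using hmax (show (r, z) ∈ _ from ⟨hr, hz⟩)
    have hA := opA_nonneg_of_isLocalMax σM ((hJx r hr').sub hψ) hlocmax
    have hgrad : gradient (fun z : Euc n => J r z - e * (1 + ‖z‖ ^ 2)) y = 0 := by
      simp [gradient, hlocmax.fderiv_eq_zero]
    rw [opA_sub _ (hJx r hr') hψ, opA_const_mul_one_add_norm_sq] at hA
    rw [gradient_fun_sub ((hJx r hr').differentiable (by norm_num) y)
      (hψ.differentiable (by norm_num) y), gradient_const_mul_one_add_norm_sq, sub_eq_zero] at hgrad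
    have hψs : HasDerivAt (fun q : ℝ => δ * rexp (c * (T - q)) * (1 + ‖y‖ ^ 2))
        (-(c * e * (1 + ‖y‖ ^ 2))) r := by
      refine ((((((hasDerivAt_id' r).const_sub T).const_mul c).exp).const_mul δ).mul_const
        (1 + ‖y‖ ^ 2)).congr_deriv ?_
      simp only [e]
      ring
    have hs' := deriv_nonpos_of_forall_Icc_le hr'.2 ((hJs y r hr').hasDerivAt.sub hψs)
      fun q hq => hmax (show (q, y) ∈ _ from
        ⟨⟨hr.1.trans hq.1, hq.2⟩, by simp [hyR.le]⟩)
    have hE := heq r hr' y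
    rw [hgrad, inner_smul_right] at hE
    have hgy : ⟪g r y, y⟫ ≤ K * (1 + ‖y‖) * ‖y‖ :=
      (real_inner_le_norm _ _).trans (by gcongr; exact hg r hr y)
    have hin : ⟪g r y, y⟫ ≤ 2 * K * (1 + ‖y‖ ^ 2) := by
      nlinarith [mul_nonneg hK.le (sq_nonneg (‖y‖ - 1)), mul_nonneg hK.le (sq_nonneg ‖y‖)]
    have hτ : τ ≤ |τ| * (1 + ‖y‖ ^ 2) :=
      (le_abs_self τ).trans (le_mul_of_one_le_right (abs_nonneg τ) (by nlinarith [sq_nonneg ‖y‖]))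
    have hpos : 0 < c * (1 + ‖y‖ ^ 2) - τ - 2 * ⟪g r y, y⟫ := by
      simp only [c]
      nlinarith [sq_nonneg ‖y‖]
    nlinarith [mul_pos he hpos]
  have hlim : Filter.Tendsto (fun δ : ℝ => δ * rexp (c * (T - s)) * (1 + ‖x‖ ^ 2))
      (nhdsWithin 0 (Set.Ioi 0)) (nhds 0) := by
    have h : Continuous fun δ : ℝ => δ * rexp (c * (T - s)) * (1 + ‖x‖ ^ 2) := by fun_prop
    simpa using (h.tendsto 0).mono_left nhdsWithin_le_nhds
  exact ge_of_tendsto hlim (Filter.eventually_of_mem self_mem_nhdsWithin key)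

theorem linear_operator_sub {n : ℕ} (a : Matrix (Fin n) (Fin n) ℝ) {J₁ J₂ : ℝ → Euc n → ℝ} {s : ℝ}
    {x : Euc n} (v : Euc n) (h₁s : DifferentiableAt ℝ (fun σ' => J₁ σ' x) s)
    (h₂s : DifferentiableAt ℝ (fun σ' => J₂ σ' x) s) (h₁x : ContDiff ℝ 2 (J₁ s))
    (h₂x : ContDiff ℝ 2 (J₂ s)) :
    -(deriv (fun σ' => J₁ σ' x - J₂ σ' x) s) + opA n a (fun y => J₁ s y - J₂ s y) x
        - ⟪v, gradient (fun y => J₁ s y - J₂ s y) x⟫ =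
      (-(deriv (fun σ' => J₁ σ' x) s) + opA n a (J₁ s) x - ⟪v, gradient (J₁ s) x⟫) -
        (-(deriv (fun σ' => J₂ σ' x) s) + opA n a (J₂ s) x - ⟪v, gradient (J₂ s) x⟫) := by
  rw [deriv_fun_sub h₁s h₂s, opA_sub a h₁x h₂x, gradient_fun_sub
    (h₁x.differentiable (by norm_num) x) (h₂x.differentiable (by norm_num) x), inner_sub_right]
  ring

/-- Comparison principle for two solutions of the same equation with the same terminal data. -/
theorem linear_parabolic_le {n : ℕ} (σM : Matrix (Fin n) (Fin n) ℝ) {t T K : ℝ} (hK : 0 < K)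
    {g : ℝ → Euc n → Euc n}
    (hg : ∀ s ∈ Set.Icc t T, ∀ x : Euc n, ‖g s x‖ ≤ K * (1 + ‖x‖)) {l J₁ J₂ : ℝ → Euc n → ℝ}
    {lT : Euc n → ℝ}
    (h₁ : ContinuousOn (fun p : ℝ × Euc n => J₁ p.1 p.2) (Set.Icc t T ×ˢ Set.univ))
    (h₂ : ContinuousOn (fun p : ℝ × Euc n => J₂ p.1 p.2) (Set.Icc t T ×ˢ Set.univ))
    (h₁s : ∀ x : Euc n, ∀ s ∈ Set.Ico t T, DifferentiableAt ℝ (fun σ' => J₁ σ' x) s)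
    (h₂s : ∀ x : Euc n, ∀ s ∈ Set.Ico t T, DifferentiableAt ℝ (fun σ' => J₂ σ' x) s)
    (h₁x : ∀ s ∈ Set.Ico t T, ContDiff ℝ 2 (J₁ s))
    (h₂x : ∀ s ∈ Set.Ico t T, ContDiff ℝ 2 (J₂ s))
    (h₁eq : ∀ s ∈ Set.Ico t T, ∀ x : Euc n, -(deriv (fun σ' => J₁ σ' x) s) +
      opA n (σM * σMᵀ) (J₁ s) x - ⟪g s x, gradient (J₁ s) x⟫ = l s x)
    (h₂eq : ∀ s ∈ Set.Ico t T, ∀ x : Euc n, -(deriv (fun σ' => J₂ σ' x) s) +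
      opA n (σM * σMᵀ) (J₂ s) x - ⟪g s x, gradient (J₂ s) x⟫ = l s x)
    (h₁T : ∀ x : Euc n, J₁ T x = lT x) (h₂T : ∀ x : Euc n, J₂ T x = lT x)
    (hsub : ∀ ε > (0 : ℝ), ∃ R : ℝ, ∀ x : Euc n, R ≤ ‖x‖ → ∀ s ∈ Set.Icc t T,
      |J₁ s x - J₂ s x| ≤ ε * (1 + ‖x‖ ^ 2))
    {s : ℝ} (hs : s ∈ Set.Icc t T) (x : Euc n) : J₁ s x ≤ J₂ s x := by
  refine sub_nonpos.1 (linear_parabolic_nonpos (J := fun s x => J₁ s x - J₂ s x) σM hK hg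
    (h₁.sub h₂) (fun x s hs => (h₁s x s hs).sub (h₂s x s hs))
    (fun s hs => (h₁x s hs).sub (h₂x s hs)) (fun s hs x => ?_)
    (fun x => by rw [h₁T, h₂T, sub_self]) hsub hs x)
  rw [linear_operator_sub _ _ (h₁s x s hs) (h₂s x s hs) (h₁x s hs) (h₂x s hs), h₁eq s hs x,
    h₂eq s hs x, sub_self]

/-- **uniqueness for the linear parabolic equation among sub-quadratic
solutions.** A solution of the homogeneous equation `−∂_s J + 𝒜J − g·DJ = 0` with `J(T,·) = 0`
and `sup_s |J(s,x)|/(1+|x|²) → 0` as `|x| → ∞` vanishes identically; consequently two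
solutions with the same data, whose difference is `o(1+|x|²)` uniformly in `s`, coincide. -/
theorem linear_parabolic_uniqueness
    (n : ℕ) (hn : 1 ≤ n) (σM : Matrix (Fin n) (Fin n) ℝ) (hσ : IsUnit σM.det)
    (a : Matrix (Fin n) (Fin n) ℝ) (ha : a = σM * σMᵀ)
    (t T K : ℝ) (htT : t < T) (hK : 0 < K)
    (g : ℝ → Euc n → Euc n)
    (hgcont : ContinuousOn (fun p : ℝ × Euc n => g p.1 p.2) (Set.Icc t T ×ˢ Set.univ))
    (hg : ∀ s ∈ Set.Icc t T, ∀ x : Euc n, ‖g s x‖ ≤ K * (1 + ‖x‖)) :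
    -- vanishing of sub-quadratic solutions of the homogeneous problem
    (∀ J : ℝ → Euc n → ℝ,
      ContinuousOn (fun p : ℝ × Euc n => J p.1 p.2) (Set.Icc t T ×ˢ Set.univ) →
      (∀ x : Euc n, ∀ s ∈ Set.Ico t T, DifferentiableAt ℝ (fun σ' => J σ' x) s) →
      (∀ s ∈ Set.Ico t T, ContDiff ℝ 2 (J s)) →
      (∀ s ∈ Set.Ico t T, ∀ x : Euc n,
        -(deriv (fun σ' => J σ' x) s) + opA n a (J s) x - ⟪g s x, gradient (J s) x⟫ = 0) →
      (∀ x : Euc n, J T x = 0) →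
      (∀ ε > (0 : ℝ), ∃ R : ℝ, ∀ x : Euc n, R ≤ ‖x‖ → ∀ s ∈ Set.Icc t T,
        |J s x| ≤ ε * (1 + ‖x‖ ^ 2)) →
      ∀ s ∈ Set.Icc t T, ∀ x : Euc n, J s x = 0) ∧
    -- consequently, two sub-quadratically-separated solutions with the same data coincide
    (∀ (l : ℝ → Euc n → ℝ) (lT : Euc n → ℝ) (J₁ J₂ : ℝ → Euc n → ℝ),
      ContinuousOn (fun p : ℝ × Euc n => J₁ p.1 p.2) (Set.Icc t T ×ˢ Set.univ) →
      ContinuousOn (fun p : ℝ × Euc n => J₂ p.1 p.2) (Set.Icc t T ×ˢ Set.univ) →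
      (∀ x : Euc n, ∀ s ∈ Set.Ico t T, DifferentiableAt ℝ (fun σ' => J₁ σ' x) s) →
      (∀ x : Euc n, ∀ s ∈ Set.Ico t T, DifferentiableAt ℝ (fun σ' => J₂ σ' x) s) →
      (∀ s ∈ Set.Ico t T, ContDiff ℝ 2 (J₁ s)) →
      (∀ s ∈ Set.Ico t T, ContDiff ℝ 2 (J₂ s)) →
      (∀ s ∈ Set.Ico t T, ∀ x : Euc n,
        -(deriv (fun σ' => J₁ σ' x) s) + opA n a (J₁ s) x - ⟪g s x, gradient (J₁ s) x⟫
          = l s x) →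
      (∀ s ∈ Set.Ico t T, ∀ x : Euc n,
        -(deriv (fun σ' => J₂ σ' x) s) + opA n a (J₂ s) x - ⟪g s x, gradient (J₂ s) x⟫
          = l s x) →
      (∀ x : Euc n, J₁ T x = lT x) → (∀ x : Euc n, J₂ T x = lT x) →
      (∀ ε > (0 : ℝ), ∃ R : ℝ, ∀ x : Euc n, R ≤ ‖x‖ → ∀ s ∈ Set.Icc t T,
        |J₁ s x - J₂ s x| ≤ ε * (1 + ‖x‖ ^ 2)) →
      ∀ s ∈ Set.Icc t T, ∀ x : Euc n, J₁ s x = J₂ s x) := by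
  subst ha
  refine (and_iff_right_of_imp fun unique J hJ hJs hJx heq hT hsub => ?_).2
    fun l lT J₁ J₂ h₁ h₂ h₁s h₂s h₁x h₂x h₁eq h₂eq h₁T h₂T hsub s hs x => le_antisymm
      (linear_parabolic_le σM hK hg h₁ h₂ h₁s h₂s h₁x h₂x h₁eq h₂eq h₁T h₂T hsub hs x)
      (linear_parabolic_le σM hK hg h₂ h₁ h₂s h₁s h₂x h₁x h₂eq h₁eq h₂T h₁T
        (fun ε hε => by simpa only [abs_sub_comm] using hsub ε hε) hs x)
  refine unique (fun _ _ => 0) (fun _ => 0) J (fun _ _ => 0) hJ continuousOn_const hJs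
    (fun _ _ _ => differentiableAt_const _) hJx (fun _ _ => contDiff_const) heq
    (fun s _ x => ?_) hT (fun _ => rfl) (by simpa using hsub)
  simp [opA, secondPartial, gradient]

end
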